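/- arXiv:1009.5097 — 12 statements merged into one kernel-verified Lean document; each statement's English description precedes it below -/
import Mathlib

section
/- Let G be a group and let N be a finite subgroup of G contained in the center of G. Suppose the quotient group G/N is commutative and divisible, i.e. for every coset x ∈ G/N and every positive integer m there is y ∈ G/N with yᵐ = x. Then G is commutative. -/
/-- If `c` commutes with `b` modulo a finite central subgroup `N`, then `c ^ |N|` commutes
with `b`. -/
theorem Subgroup.commute_pow_card_of_le_center {G : Type*} [Group G] {N : Subgroup G}
    (hN : N ≤ Subgroup.center G) {b c : G} (h : c⁻¹ * (b * c * b⁻¹) ∈ N) :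
    Commute b (c ^ Nat.card N) := by
  have hz : (c⁻¹ * (b * c * b⁻¹)) ^ Nat.card N = 1 :=
    congrArg Subtype.val (pow_card_eq_one' (x := (⟨_, h⟩ : N)))
  have hc : Commute c (c⁻¹ * (b * c * b⁻¹)) := Subgroup.mem_center_iff.mp (hN h) c
  have hconj : b * c ^ Nat.card N * b⁻¹ = c ^ Nat.card N := by
    rw [← conj_pow, ← mul_inv_cancel_left c (b * c * b⁻¹), hc.mul_pow, hz, mul_one]
  exact mul_inv_eq_iff_eq_mul.mp hconj

/-- A finite central extension of a commutative divisible group is commutative. -/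
theorem stmt_1 {G : Type*} [Group G] (N : Subgroup G) [N.Normal]
    (hN : N ≤ Subgroup.center G) [Finite N]
    (hcomm : ∀ x y : G ⧸ N, x * y = y * x)
    (hdiv : ∀ (x : G ⧸ N) (m : ℕ), 0 < m → ∃ y : G ⧸ N, y ^ m = x) :
    ∀ a b : G, a * b = b * a := by
  intro a b
  obtain ⟨y, hy⟩ := hdiv a (Nat.card N) Nat.card_pos
  obtain ⟨c, rfl⟩ := QuotientGroup.mk_surjective y
  have hn : (c ^ Nat.card N)⁻¹ * a ∈ N := QuotientGroup.eq.mp hy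
  have hcb : c⁻¹ * (b * c * b⁻¹) ∈ N := by
    refine QuotientGroup.eq.mp ?_
    rw [QuotientGroup.mk_mul, QuotientGroup.mk_mul, QuotientGroup.mk_inv, hcomm b c,
      mul_inv_cancel_right]
  have hb : Commute b ((c ^ Nat.card N)⁻¹ * a) := Subgroup.mem_center_iff.mp (hN hn) b
  have hba := (Subgroup.commute_pow_card_of_le_center hN hcb).mul_right hb
  rw [mul_inv_cancel_left] at hba
  exact hba.symm
end

section
/- Let π : G → H be a surjective homomorphism of abelian groups whose kernel is finite with exactly n elements. Then there is a unique group homomorphism φ : H → G such that φ(π(g)) = n·g for all g ∈ G, and the kernel of φ equals the image under π of the n-torsion subgroup {g ∈ G : n·g = 0} of G. -/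
/-- If `π : G → H` is a surjective homomorphism of abelian groups with finite kernel of
cardinality `n`, then there is a unique homomorphism `φ : H → G` with `φ (π g) = n • g`,
and its kernel is the image under `π` of the `n`-torsion subgroup of `G`. -/
theorem stmt_2 {G H : Type*} [AddCommGroup G] [AddCommGroup H] (π : G →+ H)
    (hsurj : Function.Surjective π) [Finite π.ker] (n : ℕ) (hn : Nat.card π.ker = n) :
    ∃ φ : H →+ G, (∀ g : G, φ (π g) = n • g) ∧
      (∀ ψ : H →+ G, (∀ g : G, ψ (π g) = n • g) → ψ = φ) ∧
      (∀ x : H, φ x = 0 ↔ ∃ g : G, n • g = 0 ∧ π g = x) := by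
  have hker : π.ker ≤ (nsmulAddMonoidHom n : G →+ G).ker := by
    intro g hg
    have h := card_nsmul_eq_zero' (x := (⟨g, hg⟩ : π.ker))
    rw [hn] at h
    exact congrArg Subtype.val h
  let φ : H →+ G := π.liftOfSurjective hsurj ⟨nsmulAddMonoidHom n, hker⟩
  have hφ : ∀ g : G, φ (π g) = n • g := fun g =>
    AddMonoidHom.liftOfRightInverse_comp_apply π _ (Function.rightInverse_surjInv hsurj)
      ⟨nsmulAddMonoidHom n, hker⟩ g
  refine ⟨φ, hφ, fun ψ hψ => ?_, fun x => ⟨fun hx => ?_, ?_⟩⟩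
  · ext x
    obtain ⟨g, rfl⟩ := hsurj x
    rw [hψ, hφ]
  · obtain ⟨g, rfl⟩ := hsurj x
    exact ⟨g, (hφ g).symm.trans hx, rfl⟩
  · rintro ⟨g, hg, rfl⟩
    rw [hφ, hg]
end

section
/- Let π : G → H and π' : G' → H be surjective group homomorphisms, and suppose the kernel of π' is contained in the center of G' and has exactly n elements. If f₁, f₂ : G → G' are group homomorphisms with π' ∘ f₁ = π and π' ∘ f₂ = π, then f₁(yⁿ) = f₂(yⁿ) for every y ∈ G. In particular f₁ and f₂ agree on the subgroup of G generated by n-th powers. -/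
/-- If `π : G → H` and `π' : G' → H` are surjective homomorphisms, `ker π'` is central in
`G'` with exactly `n` elements, and `f₁ f₂ : G → G'` are homomorphisms over `H`, then
`f₁` and `f₂` agree on `n`-th powers, hence on the subgroup generated by `n`-th powers. -/
theorem stmt_6 {G G' H : Type*} [Group G] [Group G'] [Group H]
    (π : G →* H) (π' : G' →* H)
    (hsurj : Function.Surjective π) (hsurj' : Function.Surjective π')
    (hcent : π'.ker ≤ Subgroup.center G') [Finite π'.ker]
    (n : ℕ) (hn : Nat.card π'.ker = n)
    (f₁ f₂ : G →* G') (h₁ : π'.comp f₁ = π) (h₂ : π'.comp f₂ = π) :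
    (∀ y : G, f₁ (y ^ n) = f₂ (y ^ n)) ∧
    (∀ g ∈ Subgroup.closure {x : G | ∃ y : G, x = y ^ n}, f₁ g = f₂ g) := by
  have key : ∀ y : G, f₁ (y ^ n) = f₂ (y ^ n) := by
    intro y
    have hy : π' (f₁ y) = π' (f₂ y) := DFunLike.congr_fun (h₁.trans h₂.symm) y
    have hmem : (f₂ y)⁻¹ * f₁ y ∈ π'.ker := by
      simp [MonoidHom.mem_ker, hy]
    have hpow : ((f₂ y)⁻¹ * f₁ y) ^ n = 1 := by
      rw [← hn]
      exact congrArg Subtype.val (pow_card_eq_one' (x := (⟨_, hmem⟩ : π'.ker)))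
    have hcomm : Commute (f₂ y) ((f₂ y)⁻¹ * f₁ y) :=
      Subgroup.mem_center_iff.mp (hcent hmem) (f₂ y)
    calc f₁ (y ^ n) = (f₂ y * ((f₂ y)⁻¹ * f₁ y)) ^ n := by rw [mul_inv_cancel_left, map_pow]
      _ = f₂ (y ^ n) := by rw [hcomm.mul_pow, hpow, mul_one, map_pow]
  refine ⟨key, fun g hg => ?_⟩
  refine MonoidHom.eqOn_closure (f := f₁) (g := f₂) ?_ hg
  rintro _ ⟨y, rfl⟩
  exact key y
end

section
/- For every compatible sequence h : ℕ⁺ → ℝ/ℤ (i.e. k • h(i·k) = h(i) for all positive integers i, k) and every finite set F of positive integers, there exists x ∈ ℝ such that h(n) = mod_ℤ(x/n) for all n ∈ F. In other words, the image of ℝ under x ↦ (mod_ℤ(x/n))_{n ∈ ℕ⁺} is dense in the inverse limit of the finite covers of the circle group. -/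
/-- The image of `ℝ` under `x ↦ (mod_ℤ (x / n))_{n ∈ ℕ+}` is dense in the inverse limit of
the finite covers of the circle group: every compatible sequence agrees with some `ẑ x` on
any prescribed finite set of coordinates. -/
theorem stmt_8 (h : ℕ+ → AddCircle (1 : ℝ))
    (hcomp : ∀ i k : ℕ+, (k : ℕ) • h (i * k) = h i) (F : Finset ℕ+) :
    ∃ x : ℝ, ∀ n ∈ F, h n = ((x / ((n : ℕ) : ℝ) : ℝ) : AddCircle (1 : ℝ)) := by
  obtain ⟨y, hy⟩ := QuotientAddGroup.mk_surjective (h (∏ m ∈ F, m))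
  refine ⟨(((∏ m ∈ F, m : ℕ+) : ℕ) : ℝ) * y, fun n hn => ?_⟩
  obtain ⟨k, hk⟩ := Finset.dvd_prod_of_mem (fun m : ℕ+ => m) hn
  have hn0 : ((n : ℕ) : ℝ) ≠ 0 := by exact_mod_cast n.ne_zero
  have hx : (((∏ m ∈ F, m : ℕ+) : ℕ) : ℝ) * y / ((n : ℕ) : ℝ) = (k : ℕ) • y := by
    rw [hk, PNat.mul_coe, Nat.cast_mul, nsmul_eq_mul]
    field_simp
  rw [hx, AddCircle.coe_nsmul, ← hcomp n k, ← hk, ← hy]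
end

section
/- Let h : ℕ⁺ → ℝ/ℤ be a compatible sequence, i.e. k • h(i·k) = h(i) for all positive integers i, k. Then there exists x ∈ ℝ such that h(n) = mod_ℤ(x/n) for all n ∈ ℕ⁺ if and only if h(n) tends to 0 in ℝ/ℤ as n → ∞. -/
lemma UnitAddCircle.exists_coe_eq_abs_eq_norm (u : AddCircle (1 : ℝ)) :
    ∃ r : ℝ, (r : AddCircle (1 : ℝ)) = u ∧ |r| = ‖u‖ := by
  obtain ⟨y, rfl⟩ := QuotientAddGroup.mk_surjective u
  refine ⟨y - round y, ?_, (UnitAddCircle.norm_eq (x := y)).symm⟩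
  rw [AddCircle.coe_sub, sub_eq_self, AddCircle.coe_eq_zero_iff]
  exact ⟨round y, by simp⟩

/-- Lifts to `ℝ` of absolute value less than `1/4` of the terms of index at least `N` of a
compatible sequence satisfy the compatibility relation in `ℝ`. -/
lemma lift_eq_mul_lift_of_compatible {h : ℕ+ → AddCircle (1 : ℝ)}
    (hcomp : ∀ i k : ℕ+, (k : ℕ) • h (i * k) = h i) {r : ℕ+ → ℝ}
    (hr : ∀ n, (r n : AddCircle (1 : ℝ)) = h n) {N : ℕ+} (hN : ∀ n ≥ N, |r n| < 1 / 4)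
    (k : ℕ+) : ((k : ℕ) : ℝ) * r (N * k) = r N := by
  have exists_int (i k : ℕ+) : ∃ d : ℤ, (d : ℝ) = (k : ℕ) * r (i * k) - r i := by
    have := hcomp i k
    rw [← hr, ← hr, ← AddCircle.coe_nsmul, ← sub_eq_zero, ← AddCircle.coe_sub,
      AddCircle.coe_eq_zero_iff] at this
    simpa using this
  have double (n : ℕ+) (hn : N ≤ n) : 2 * r (n * 2) = r n := by
    obtain ⟨d, hd⟩ := exists_int n 2
    have h1 := abs_lt.1 (hN n hn)
    have h2 := abs_lt.1 (hN (n * 2) (hn.trans (PNat.le_of_dvd (dvd_mul_right n 2))))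
    have hd' : (d : ℝ) = 2 * r (n * 2) - r n := by simpa using hd
    have h3 : d < 1 := by
      have : (d : ℝ) < 1 := by linarith
      exact_mod_cast this
    have h4 : -1 < d := by
      have : (-1 : ℝ) < d := by linarith
      exact_mod_cast this
    obtain rfl : d = 0 := by lia
    simp only [Int.cast_zero] at hd'
    linarith
  have double_pow (n : ℕ+) (hn : N ≤ n) (m : ℕ) : 2 ^ m * r (n * 2 ^ m) = r n := by
    induction m with
    | zero => simp
    | succ m ih =>
      rw [← ih, ← double (n * 2 ^ m) (hn.trans (PNat.le_of_dvd (dvd_mul_right _ _))),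
        mul_assoc n, ← pow_succ]
      ring
  obtain ⟨d, hd⟩ := exists_int N k
  have hdvd : (2 : ℤ) ^ d.natAbs ∣ d := by
    obtain ⟨e, he⟩ := exists_int (N * 2 ^ d.natAbs) k
    refine ⟨e, ?_⟩
    have : (d : ℝ) = 2 ^ d.natAbs * e := by
      rw [hd, he, ← double_pow N le_rfl d.natAbs,
        ← double_pow (N * k) (PNat.le_of_dvd (dvd_mul_right _ _)) d.natAbs,
        mul_right_comm N k]
      ring
    exact_mod_cast this
  have hd0 : d = 0 := by
    refine Int.eq_zero_of_abs_lt_dvd hdvd ?_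
    rw [Int.abs_eq_natAbs]
    exact_mod_cast Nat.lt_two_pow_self
  rw [hd0, Int.cast_zero] at hd
  linarith

/-- A compatible sequence `h : ℕ+ → ℝ/ℤ` is of the form `h n = mod_ℤ (x / n)` for some real
`x` if and only if `h n → 0` as `n → ∞`. -/
theorem stmt_9 (h : ℕ+ → AddCircle (1 : ℝ))
    (hcomp : ∀ i k : ℕ+, (k : ℕ) • h (i * k) = h i) :
    (∃ x : ℝ, ∀ n : ℕ+, h n = ((x / ((n : ℕ) : ℝ) : ℝ) : AddCircle (1 : ℝ))) ↔
      Filter.Tendsto h Filter.atTop (nhds 0) := by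
  constructor
  · rintro ⟨x, hx⟩
    rw [funext hx, ← AddCircle.coe_zero]
    exact ((AddCircle.continuous_mk' (1 : ℝ)).tendsto 0).comp
      ((tendsto_const_div_atTop_nhds_zero_nat x).comp tendsto_PNat_val_atTop_atTop)
  · intro hlim
    choose r hr hrn using fun n => UnitAddCircle.exists_coe_eq_abs_eq_norm (h n)
    have hsmall : ∀ᶠ n in Filter.atTop, ‖h n‖ < 1 / 4 :=
      (tendsto_zero_iff_norm_tendsto_zero.1 hlim).eventually_lt_const (by norm_num)
    obtain ⟨N, hN⟩ := Filter.eventually_atTop.1 hsmall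
    refine ⟨(N : ℕ) * r N, fun n => ?_⟩
    have hn : ((n : ℕ) : ℝ) ≠ 0 := by exact_mod_cast n.ne_zero
    rw [← hcomp n N, mul_comm n N, ← hr, ← AddCircle.coe_nsmul, nsmul_eq_mul,
      ← lift_eq_mul_lift_of_compatible hcomp hr (fun n hn => (hrn n).trans_lt (hN n hn)) n]
    congr 1
    field_simp
end

section
/- Let b : ℕ⁺ → ℝ/ℤ be a compatible sequence, i.e. k • b(i·k) = b(i) for all positive integers i, k. Suppose (i) b(n) tends to 0 in ℝ/ℤ as n → ∞, and (ii) b(i) = 0 for infinitely many values of i. Then b(i) = 0 for all i. -/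
theorem AddCircle.eq_zero_of_nsmul_eq_zero_of_norm_lt {x : AddCircle (1 : ℝ)} {k : ℕ}
    (hk : 0 < k) (hx : k • x = 0) (hnorm : k * ‖x‖ < 1) : x = 0 := by
  induction x using QuotientAddGroup.induction_on with | H c => ?_
  have hk' : (0 : ℝ) < k := by exact_mod_cast hk
  have hcoe : ((k • c : ℝ) : AddCircle (1 : ℝ)) = 0 := by rw [AddCircle.coe_nsmul]; exact hx
  obtain ⟨m, hm⟩ := (AddCircle.coe_eq_zero_iff (1 : ℝ)).1 hcoe
  simp only [zsmul_eq_mul, mul_one, nsmul_eq_mul] at hm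
  have hn : ‖(c : AddCircle (1 : ℝ))‖ = |c - round c| := by
    simp [AddCircle.norm_eq]
  change k * ‖(c : AddCircle (1 : ℝ))‖ < 1 at hnorm
  rw [hn, ← abs_of_pos hk', ← abs_mul] at hnorm
  have hint : (k : ℝ) * (c - round c) = ((m - k * round c : ℤ) : ℝ) := by
    push_cast; rw [hm]; ring
  rw [hint, ← Int.cast_abs] at hnorm
  have hzero : m - k * round c = 0 := Int.abs_lt_one_iff.1 (by exact_mod_cast hnorm)
  rw [hzero, Int.cast_zero, mul_eq_zero, or_iff_right hk'.ne', sub_eq_zero] at hint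
  exact (AddCircle.coe_eq_zero_iff (1 : ℝ)).2 ⟨round c, by simpa using hint.symm⟩

/-- A compatible sequence in the inverse limit of the finite covers of the circle that tends
to `0` and vanishes at infinitely many indices vanishes identically. -/
theorem stmt_10 (b : ℕ+ → AddCircle (1 : ℝ))
    (hcomp : ∀ i k : ℕ+, (k : ℕ) • b (i * k) = b i)
    (hlim : Filter.Tendsto b Filter.atTop (nhds 0))
    (hinf : {i : ℕ+ | b i = 0}.Infinite) :
    ∀ i : ℕ+, b i = 0 := by
  have hsmall (k : ℕ+) : ∃ N, ∀ n ≥ N, (k : ℕ) * ‖b n‖ < 1 := by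
    have h : Filter.Tendsto (fun n ↦ ((k : ℕ) : ℝ) * ‖b n‖) Filter.atTop (nhds 0) := by
      simpa using hlim.norm.const_mul ((k : ℕ) : ℝ)
    exact Filter.eventually_atTop.1 (h.eventually_lt_const one_pos)
  obtain ⟨N, hN⟩ := hsmall 2
  obtain ⟨n, hn, hNn⟩ := hinf.exists_gt N
  have hpow (j : ℕ) : b (n * 2 ^ j) = 0 := by
    induction j with
    | zero => simpa using hn
    | succ j ih =>
      have hle : n ≤ n * 2 ^ (j + 1) := le_mul_of_one_le_right' one_le
      refine AddCircle.eq_zero_of_nsmul_eq_zero_of_norm_lt (2 : ℕ+).pos ?_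
        (hN _ (hNn.le.trans hle))
      rw [pow_succ, ← mul_assoc, hcomp, ih]
  intro k
  obtain ⟨M, hM⟩ := hsmall k
  have hMle : M ≤ n * 2 ^ (M : ℕ) * k := by
    have h : M ≤ 2 ^ (M : ℕ) := by
      rw [← PNat.coe_le_coe, PNat.pow_coe]
      exact Nat.lt_two_pow_self.le
    exact (h.trans (le_mul_of_one_le_left' one_le)).trans
      (le_mul_of_one_le_right' one_le)
  have hzero : b (n * 2 ^ (M : ℕ) * k) = 0 :=
    AddCircle.eq_zero_of_nsmul_eq_zero_of_norm_lt k.pos (by rw [hcomp, hpow]) (hM _ hMle)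
  rw [← hcomp k (n * 2 ^ (M : ℕ)), mul_comm k, hzero, smul_zero]
end

section
/- Let V₁ and V₂ be torsion-free divisible abelian groups, and let Γ₁ ≤ V₁ and Γ₂ ≤ V₂ be subgroups such that Γ₁ and Γ₂ are infinite, the cardinality of Γ₁ is strictly less than that of V₁, and the cardinality of Γ₂ is strictly less than that of V₂. Suppose there is a group isomorphism f : Γ₁ → Γ₂ and a group isomorphism V₁/Γ₁ ≅ V₂/Γ₂. Then there is a group isomorphism F : V₁ → V₂ with F(x) = f(x) for all x ∈ Γ₁; in particular F maps Γ₁ onto Γ₂, so the isomorphism type of the pair (V,+,Γ) is determined by the isomorphism types of Γ and of V/Γ. -/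
theorem Module.Baer.of_exists_zsmul_eq {A : Type*} [AddCommGroup A]
    (h : ∀ (x : A) (n : ℤ), n ≠ 0 → ∃ y : A, n • y = x) : Module.Baer ℤ A :=
  letI : DivisibleBy A ℤ := divisibleByOfSMulRightSurj A ℤ fun hn x => h x _ hn
  Module.Baer.of_divisible A

/-- An epimorphism of abelian groups whose kernel is injective splits. -/
theorem AddMonoidHom.exists_addEquiv_ker_prod {V T : Type*} [AddCommGroup V] [AddCommGroup T]
    (p : V →+ T) (hp : Function.Surjective p) (hk : Module.Baer ℤ p.ker) :
    ∃ e : V ≃+ p.ker × T, ∀ x : p.ker, e x = (x, 0) := by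
  obtain ⟨r, hr⟩ := hk.extension_property_addMonoidHom p.ker.subtype
    p.ker.subtype_injective (AddMonoidHom.id _)
  have hr' (x : p.ker) : r x = x := DFunLike.congr_fun hr x
  refine ⟨AddEquiv.ofBijective (r.prod p) ⟨?_, ?_⟩, fun x => Prod.ext (hr' x) x.2⟩
  · refine (injective_iff_map_eq_zero _).2 fun x hx => ?_
    obtain ⟨hrx, hpx⟩ := Prod.mk_eq_zero.1 hx
    exact congrArg Subtype.val ((hr' ⟨x, hpx⟩).symm.trans hrx)
  · rintro ⟨d, t⟩
    obtain ⟨y, rfl⟩ := hp t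
    refine ⟨y - r y + d, Prod.ext ?_ ?_⟩
    · simp [hr']
    · have h₁ : p (r y) = 0 := (r y).2
      have h₂ : p d = 0 := d.2
      simp [h₁, h₂]

/-- An isomorphism between the injective kernels of two epimorphisms onto the same abelian group
extends to an isomorphism of the sources. -/
theorem AddMonoidHom.exists_addEquiv_extending_ker {V₁ V₂ T : Type*} [AddCommGroup V₁]
    [AddCommGroup V₂] [AddCommGroup T] (p₁ : V₁ →+ T) (p₂ : V₂ →+ T)
    (hp₁ : Function.Surjective p₁) (hp₂ : Function.Surjective p₂)
    (hk₁ : Module.Baer ℤ p₁.ker) (hk₂ : Module.Baer ℤ p₂.ker) (φ : p₁.ker ≃+ p₂.ker) :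
    ∃ F : V₁ ≃+ V₂, ∀ x : p₁.ker, F x = φ x := by
  obtain ⟨e₁, he₁⟩ := p₁.exists_addEquiv_ker_prod hp₁ hk₁
  obtain ⟨e₂, he₂⟩ := p₂.exists_addEquiv_ker_prod hp₂ hk₂
  refine ⟨(e₁.trans (φ.prodCongr (AddEquiv.refl T))).trans e₂.symm, fun x => ?_⟩
  apply e₂.injective
  rw [he₂]
  simp only [AddEquiv.trans_apply, he₁, AddEquiv.apply_symm_apply]
  rfl

/-- If `D` consists of the elements with a nonzero multiple in `Γ` and the ambient group is
divisible, then `D` is injective. -/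
theorem AddSubgroup.baer_of_mem_iff_exists_zsmul_mem {V : Type*} [AddCommGroup V]
    (hdiv : ∀ (x : V) (n : ℤ), n ≠ 0 → ∃ y : V, n • y = x) {Γ D : AddSubgroup V}
    (hD : ∀ x, x ∈ D ↔ ∃ n : ℤ, n ≠ 0 ∧ n • x ∈ Γ) : Module.Baer ℤ D := by
  refine Module.Baer.of_exists_zsmul_eq fun x n hn => ?_
  obtain ⟨y, hy⟩ := hdiv x n hn
  obtain ⟨m, hm, hmx⟩ := (hD x).1 x.2
  exact ⟨⟨y, (hD y).2 ⟨m * n, mul_ne_zero hm hn, by rwa [mul_smul, hy]⟩⟩, Subtype.ext hy⟩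

/-- If `k` is a left inverse of `h` on `Γ` and `V₁` is torsion-free, then `k` is a left inverse
of `h` on every element having a nonzero multiple in `Γ`. -/
theorem AddMonoidHom.leftInverse_of_zsmul_mem {V₁ V₂ : Type*} [AddCommGroup V₁] [AddCommGroup V₂]
    (htf : ∀ (x : V₁) (n : ℤ), n ≠ 0 → n • x = 0 → x = 0) {Γ : AddSubgroup V₁}
    {h : V₁ →+ V₂} {k : V₂ →+ V₁} (hkh : ∀ x ∈ Γ, k (h x) = x) {x : V₁} {n : ℤ} (hn : n ≠ 0)
    (hx : n • x ∈ Γ) : k (h x) = x := by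
  refine sub_eq_zero.1 (htf _ n hn ?_)
  rw [smul_sub, ← map_zsmul, ← map_zsmul, hkh _ hx, sub_self]

/-- An isomorphism of subgroups of torsion-free divisible groups extends to their saturations. -/
theorem AddSubgroup.exists_addEquiv_saturation {V₁ V₂ : Type*} [AddCommGroup V₁] [AddCommGroup V₂]
    (htf₁ : ∀ (x : V₁) (n : ℤ), n ≠ 0 → n • x = 0 → x = 0)
    (htf₂ : ∀ (x : V₂) (n : ℤ), n ≠ 0 → n • x = 0 → x = 0)
    (hdiv₁ : ∀ (x : V₁) (n : ℤ), n ≠ 0 → ∃ y : V₁, n • y = x)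
    (hdiv₂ : ∀ (x : V₂) (n : ℤ), n ≠ 0 → ∃ y : V₂, n • y = x)
    {Γ₁ D₁ : AddSubgroup V₁} {Γ₂ D₂ : AddSubgroup V₂}
    (hD₁ : ∀ x, x ∈ D₁ ↔ ∃ n : ℤ, n ≠ 0 ∧ n • x ∈ Γ₁)
    (hD₂ : ∀ x, x ∈ D₂ ↔ ∃ n : ℤ, n ≠ 0 ∧ n • x ∈ Γ₂) (f : Γ₁ ≃+ Γ₂) :
    ∃ φ : D₁ ≃+ D₂, ∀ (x : Γ₁) (hx : (x : V₁) ∈ D₁), (φ ⟨x, hx⟩ : V₂) = f x := by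
  obtain ⟨h, hh⟩ := (Module.Baer.of_exists_zsmul_eq hdiv₂).extension_property_addMonoidHom
    Γ₁.subtype Γ₁.subtype_injective (Γ₂.subtype.comp f.toAddMonoidHom)
  obtain ⟨k, hk⟩ := (Module.Baer.of_exists_zsmul_eq hdiv₁).extension_property_addMonoidHom
    Γ₂.subtype Γ₂.subtype_injective (Γ₁.subtype.comp f.symm.toAddMonoidHom)
  have hf (x : Γ₁) : h x = f x := DFunLike.congr_fun hh x
  have kf (x : Γ₂) : k x = f.symm x := DFunLike.congr_fun hk x
  have hkh : ∀ x ∈ Γ₁, k (h x) = x := fun x hx => by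
    rw [hf ⟨x, hx⟩, kf, f.symm_apply_apply]
  have hhk : ∀ x ∈ Γ₂, h (k x) = x := fun x hx => by
    rw [kf ⟨x, hx⟩, hf, f.apply_symm_apply]
  refine ⟨{ toFun := fun x => ⟨h x, ?_⟩
            invFun := fun x => ⟨k x, ?_⟩
            left_inv := fun x => Subtype.ext ?_
            right_inv := fun x => Subtype.ext ?_
            map_add' := fun x y => Subtype.ext (map_add h _ _) }, fun x _ => hf x⟩
  · obtain ⟨n, hn, hx⟩ := (hD₁ x).1 x.2
    exact (hD₂ _).2 ⟨n, hn, by rw [← map_zsmul, hf ⟨_, hx⟩]; exact (f _).2⟩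
  · obtain ⟨n, hn, hx⟩ := (hD₂ x).1 x.2
    exact (hD₁ _).2 ⟨n, hn, by rw [← map_zsmul, kf ⟨_, hx⟩]; exact (f.symm _).2⟩
  · obtain ⟨n, hn, hx⟩ := (hD₁ x).1 x.2
    exact AddMonoidHom.leftInverse_of_zsmul_mem htf₁ hkh hn hx
  · obtain ⟨n, hn, hx⟩ := (hD₂ x).1 x.2
    exact AddMonoidHom.leftInverse_of_zsmul_mem htf₂ hhk hn hx

/-- Membership in the preimage of the torsion subgroup of a group isomorphic to `V ⧸ Γ`. -/
theorem AddSubgroup.mk_equiv_mk_eq_zero_iff {V Q : Type*} [AddCommGroup V] [AddCommGroup Q]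
    (Γ : AddSubgroup V) (g : V ⧸ Γ ≃+ Q) (x : V) :
    (QuotientAddGroup.mk (g x) : Q ⧸ AddCommGroup.torsion Q) = 0 ↔
      ∃ n : ℤ, n ≠ 0 ∧ n • x ∈ Γ := by
  rw [QuotientAddGroup.eq_zero_iff, AddCommGroup.mem_torsion,
    isOfFinAddOrder_iff_zsmul_eq_zero]
  refine exists_congr fun n => and_congr_right fun _ => ?_
  rw [← map_zsmul, EmbeddingLike.map_eq_zero_iff, ← QuotientAddGroup.mk_zsmul,
    QuotientAddGroup.eq_zero_iff]


/-- The isomorphism type of a pair `(V, Γ)`, with `V` torsion-free divisible abelian and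
`Γ ≤ V` infinite of cardinality less than that of `V`, is determined by the isomorphism
types of `Γ` and of `V ⧸ Γ`; moreover the isomorphism may be chosen extending any given
isomorphism `Γ₁ ≃+ Γ₂`. -/
theorem stmt_12 {V₁ V₂ : Type*} [AddCommGroup V₁] [AddCommGroup V₂]
    (htf₁ : ∀ (x : V₁) (n : ℤ), n ≠ 0 → n • x = 0 → x = 0)
    (htf₂ : ∀ (x : V₂) (n : ℤ), n ≠ 0 → n • x = 0 → x = 0)
    (hdiv₁ : ∀ (x : V₁) (n : ℤ), n ≠ 0 → ∃ y : V₁, n • y = x)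
    (hdiv₂ : ∀ (x : V₂) (n : ℤ), n ≠ 0 → ∃ y : V₂, n • y = x)
    (Γ₁ : AddSubgroup V₁) (Γ₂ : AddSubgroup V₂) [Infinite Γ₁] [Infinite Γ₂]
    (hcard₁ : Cardinal.mk Γ₁ < Cardinal.mk V₁)
    (hcard₂ : Cardinal.mk Γ₂ < Cardinal.mk V₂)
    (f : Γ₁ ≃+ Γ₂) (g : V₁ ⧸ Γ₁ ≃+ V₂ ⧸ Γ₂) :
    ∃ F : V₁ ≃+ V₂, ∀ x : Γ₁, F (x : V₁) = ((f x : Γ₂) : V₂) := by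
  let π := QuotientAddGroup.mk' (AddCommGroup.torsion (V₂ ⧸ Γ₂))
  let p₁ := (π.comp g.toAddMonoidHom).comp (QuotientAddGroup.mk' Γ₁)
  let p₂ := π.comp (QuotientAddGroup.mk' Γ₂)
  have hD₁ (x : V₁) : x ∈ p₁.ker ↔ ∃ n : ℤ, n ≠ 0 ∧ n • x ∈ Γ₁ :=
    Γ₁.mk_equiv_mk_eq_zero_iff g x
  have hD₂ (x : V₂) : x ∈ p₂.ker ↔ ∃ n : ℤ, n ≠ 0 ∧ n • x ∈ Γ₂ :=
    Γ₂.mk_equiv_mk_eq_zero_iff (AddEquiv.refl _) x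
  have hπ : Function.Surjective π := QuotientAddGroup.mk'_surjective _
  obtain ⟨φ, hφ⟩ := AddSubgroup.exists_addEquiv_saturation htf₁ htf₂ hdiv₁ hdiv₂ hD₁ hD₂ f
  obtain ⟨F, hF⟩ := AddMonoidHom.exists_addEquiv_extending_ker p₁ p₂
    ((hπ.comp g.surjective).comp (QuotientAddGroup.mk'_surjective _))
    (hπ.comp (QuotientAddGroup.mk'_surjective _))
    (AddSubgroup.baer_of_mem_iff_exists_zsmul_mem hdiv₁ hD₁)
    (AddSubgroup.baer_of_mem_iff_exists_zsmul_mem hdiv₂ hD₂) φ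
  refine ⟨F, fun x => ?_⟩
  have hx : (x : V₁) ∈ p₁.ker := (hD₁ x).2 ⟨1, one_ne_zero, by rw [one_smul]; exact x.2⟩
  exact (hF ⟨x, hx⟩).trans (hφ x hx)
end

section
/- Let G be a torsion-free divisible abelian group, let ι : ℤ → G be an injective group homomorphism, and let π : G → ℝ/ℤ be a surjective group homomorphism whose kernel equals the image of ι. Then there exist a group isomorphism F : G → (ℝ,+) and a group automorphism σ of ℝ/ℤ such that F(ι(m)) = m for every m ∈ ℤ and σ(π(g)) = mod_ℤ(F(g)) for every g ∈ G. In particular, every such exact sequence 0 → ℤ → G → ℝ/ℤ → 0 is isomorphic, in the pure group language, to the universal cover 0 → ℤ → (ℝ,+) → ℝ/ℤ → 0 of the circle group, by an isomorphism fixing the kernel ℤ pointwise and permuting ℝ/ℤ by a group automorphism. -/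
/-- A torsion-free divisible abelian group is a vector space over `ℚ`. -/
noncomputable abbrev ratModuleOfDivisible {G : Type*} [AddCommGroup G]
    (htf : ∀ (x : G) (n : ℤ), n ≠ 0 → n • x = 0 → x = 0)
    (hdiv : ∀ (x : G) (n : ℤ), n ≠ 0 → ∃ y : G, n • y = x) : Module ℚ G :=
  have hden (q : ℚ) : (q.den : ℤ) ≠ 0 := by exact_mod_cast q.den_nz
  have cancel {n : ℤ} {x y : G} (hn : n ≠ 0) (h : n • x = n • y) : x = y :=
    sub_eq_zero.1 (htf _ n hn (by rw [smul_sub, h, sub_self]))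
  have hact : ∃ act : ℚ → G → G, ∀ q x, (q.den : ℤ) • act q x = q.num • x := by
    choose d hd using fun (q : ℚ) (x : G) ↦ hdiv x q.den (hden q)
    exact ⟨fun q x ↦ q.num • d q x, fun q x ↦ by rw [smul_comm, hd]⟩
  let act := hact.choose
  have den_act : ∀ q x, (q.den : ℤ) • act q x = q.num • x := hact.choose_spec
  { smul := act
    one_smul x := cancel (hden 1) ((den_act 1 x).trans (by simp))
    mul_smul p q x := by
      change act (p * q) x = act p (act q x)
      apply cancel (mul_ne_zero (mul_ne_zero (hden p) (hden q)) (hden (p * q)))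
      calc ((p.den : ℤ) * q.den * (p * q).den) • act (p * q) x
          = ((p * q).num * p.den * q.den) • x := by
            rw [mul_smul, den_act, smul_smul]; congr 1; ring
        _ = ((p * q).den * p.num * q.num) • x := by
            rw [Rat.mul_num_den']; congr 1; ring
        _ = ((p * q).den * p.num) • (q.den : ℤ) • act q x := by rw [den_act, smul_smul]
        _ = ((p * q).den * q.den : ℤ) • (p.den : ℤ) • act p (act q x) := by
            rw [den_act p, smul_smul, smul_smul]; congr 1; ring
        _ = _ := by rw [smul_smul]; congr 1; ring
    smul_zero q := cancel (hden q) ((den_act q 0).trans (by simp))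
    smul_add q x y := by
      change act q (x + y) = act q x + act q y
      apply cancel (hden q)
      simp only [smul_add, den_act]
    add_smul p q x := by
      change act (p + q) x = act p x + act q x
      apply cancel (mul_ne_zero (mul_ne_zero (hden p) (hden q)) (hden (p + q)))
      calc ((p.den : ℤ) * q.den * (p + q).den) • act (p + q) x
          = ((p + q).num * p.den * q.den) • x := by
            rw [mul_smul, den_act, smul_smul]; congr 1; ring
        _ = ((p + q).den * q.den : ℤ) • p.num • x + ((p + q).den * p.den : ℤ) • q.num • x := by
            rw [Rat.add_num_den', smul_smul, smul_smul, ← add_smul]; congr 1; ring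
        _ = _ := by
            rw [← den_act p x, ← den_act q x, smul_smul, smul_smul, smul_add]
            congr 2 <;> ring
    zero_smul x := cancel (hden 0) ((den_act 0 x).trans (by simp)) }

open Cardinal in
theorem AddCircle.mk_real_one : #(AddCircle (1 : ℝ)) = 𝔠 := by
  have : Fact ((0 : ℝ) < 1) := ⟨one_pos⟩
  rw [mk_congr (AddCircle.equivIco (1 : ℝ) 0), mk_Ico_real (by norm_num)]

open Cardinal in
/-- An extension of the circle group by a countable group has the cardinality of the continuum. -/
theorem mk_eq_continuum_of_countable_ker {G : Type*} [AddCommGroup G]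
    (π : G →+ AddCircle (1 : ℝ)) (hπ : Function.Surjective π) [Countable π.ker] : #G = 𝔠 := by
  have hquot : #(G ⧸ π.ker) = 𝔠 := by
    have h := (QuotientAddGroup.quotientKerEquivOfSurjective π hπ).toEquiv.lift_cardinal_eq
    rwa [AddCircle.mk_real_one, lift_continuum, lift_uzero] at h
  rw [mk_congr (AddSubgroup.addGroupEquivQuotientProdAddSubgroup (s := π.ker)), mk_prod,
    lift_id, lift_id, hquot]
  exact mul_eq_left aleph0_le_continuum (mk_le_aleph0.trans aleph0_le_continuum) (mk_ne_zero _)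

open Cardinal in
theorem nonempty_linearEquiv_real_of_mk_eq_continuum {V : Type*} [AddCommGroup V] [Module ℚ V]
    (hV : #V = 𝔠) : Nonempty (V ≃ₗ[ℚ] ℝ) := by
  apply nonempty_linearEquiv_of_lift_rank_eq
  rw [Module.Free.rank_eq_mk_of_infinite_lt ℚ V (by simpa [hV] using aleph0_lt_continuum), hV,
    Real.rank_rat_real, lift_continuum, lift_continuum]

/-- Every exact sequence `0 → ℤ → G → ℝ/ℤ → 0` with `G` torsion-free divisible abelian is
isomorphic, in the pure group language, to the universal cover `0 → ℤ → ℝ → ℝ/ℤ → 0` of the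
circle group, by an isomorphism fixing the kernel `ℤ` pointwise and permuting `ℝ/ℤ` by a
group automorphism. -/
theorem stmt_13 {G : Type*} [AddCommGroup G]
    (htf : ∀ (x : G) (n : ℤ), n ≠ 0 → n • x = 0 → x = 0)
    (hdiv : ∀ (x : G) (n : ℤ), n ≠ 0 → ∃ y : G, n • y = x)
    (ι : ℤ →+ G) (hι : Function.Injective ι)
    (π : G →+ AddCircle (1 : ℝ)) (hπ : Function.Surjective π)
    (hker : π.ker = ι.range) :
    ∃ (F : G ≃+ ℝ) (σ : AddCircle (1 : ℝ) ≃+ AddCircle (1 : ℝ)),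
      (∀ m : ℤ, F (ι m) = (m : ℝ)) ∧
      (∀ g : G, σ (π g) = ((F g : ℝ) : AddCircle (1 : ℝ))) := by
  let := ratModuleOfDivisible htf hdiv
  have : Countable π.ker := by
    rw [hker]
    exact (Set.countable_range ι).to_subtype
  obtain ⟨e⟩ := nonempty_linearEquiv_real_of_mk_eq_continuum
    (mk_eq_continuum_of_countable_ker π hπ)
  have hv : e (ι 1) ≠ 0 := by
    rw [e.map_ne_zero_iff, (map_ne_zero_iff ι hι)]
    exact one_ne_zero
  let F : G ≃+ ℝ := e.toAddEquiv.trans (AddAut.mulRight (Units.mk0 _ hv)⁻¹)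
  have hF (m : ℤ) : F (ι m) = m := by
    have h1 : F (ι 1) = 1 := mul_inv_cancel₀ hv
    have hm : ι m = m • ι 1 := by rw [← map_zsmul, smul_eq_mul, mul_one]
    rw [hm, map_zsmul, h1, zsmul_one]
  have hmap : π.ker.map (F : G →+ ℝ) = AddSubgroup.zmultiples 1 := by
    ext x
    simp [hker, AddSubgroup.mem_zmultiples_iff, hF]
  refine ⟨F, (QuotientAddGroup.quotientKerEquivOfSurjective π hπ).symm.trans
    (QuotientAddGroup.congr _ _ F hmap), hF, fun g ↦ ?_⟩
  have hg : (QuotientAddGroup.quotientKerEquivOfSurjective π hπ).symm (π g) = (g : G ⧸ π.ker) :=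
    (AddEquiv.symm_apply_eq _).2 rfl
  rw [AddEquiv.trans_apply, hg]
  rfl
end

section
/- Let G be a ℚ-vector space, let π : G → ℝ/ℤ be a surjective additive group homomorphism, and let e ∈ G, e ≠ 0, be such that the kernel of π is the cyclic group ℤ·e of integer multiples of e. Then for every compatible sequence h : ℕ⁺ → ℝ/ℤ (i.e. k • h(i·k) = h(i) for all positive integers i, k) and every finite set F of positive integers, there exists g ∈ G such that π((1/n)·g) = h(n) for all n ∈ F. That is, the map π̂ : G → ∏_{n ∈ ℕ⁺} ℝ/ℤ, π̂(g)(n) = π((1/n)·g), has dense image in the inverse limit of the finite covers of ℝ/ℤ. -/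
/-- If `G` is a `ℚ`-vector space and `π : G → ℝ/ℤ` a surjective homomorphism with kernel
`ℤ·e`, `e ≠ 0`, then the map `π̂ : G → ∏_{n ∈ ℕ+} ℝ/ℤ`, `π̂ g n = π ((1/n) • g)`, has dense
image in the inverse limit of the finite covers of `ℝ/ℤ`: every compatible sequence is
matched on any finite set of coordinates. -/
theorem stmt_14 {G : Type*} [AddCommGroup G] [Module ℚ G]
    (π : G →+ AddCircle (1 : ℝ)) (hπ : Function.Surjective π)
    (e : G) (he : e ≠ 0) (hker : π.ker = AddSubgroup.zmultiples e)
    (h : ℕ+ → AddCircle (1 : ℝ)) (hcomp : ∀ i k : ℕ+, (k : ℕ) • h (i * k) = h i)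
    (F : Finset ℕ+) :
    ∃ g : G, ∀ n ∈ F, π ((1 / ((n : ℕ) : ℚ)) • g) = h n := by
  obtain ⟨g, hg⟩ := hπ (h (∏ n ∈ F, n))
  refine ⟨((∏ n ∈ F, n : ℕ+) : ℕ) • g, fun n hn => ?_⟩
  obtain ⟨k, hk⟩ := Finset.dvd_prod_of_mem (fun n : ℕ+ => n) hn
  rw [hk] at hg ⊢
  have hn0 : ((n : ℕ) : ℚ) ≠ 0 := by exact_mod_cast n.ne_zero
  have hsmul : (1 / ((n : ℕ) : ℚ)) • (((n * k : ℕ+) : ℕ) • g) = (k : ℕ) • g := by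
    rw [← Nat.cast_smul_eq_nsmul ℚ, ← Nat.cast_smul_eq_nsmul ℚ, smul_smul]
    congr 1
    push_cast
    field_simp
  rw [hsmul, map_nsmul, hg, hcomp]
end

section
/- Let G be a ℚ-vector space, let π : G → ℝ/ℤ be an additive group homomorphism, and suppose the kernel of π equals ℤ·e, the set of integer multiples of a single element e ∈ G. Then the map π̂ : G → ∏_{n ∈ ℕ⁺} ℝ/ℤ defined by π̂(g)(n) = π((1/n)·g) is an injective additive group homomorphism, and its image consists of compatible sequences (k • π̂(g)(i·k) = π̂(g)(i) for all positive integers i, k). -/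
/-- In a `ℚ`-vector space, a cyclic subgroup contains no nonzero element all of whose
divisions by positive integers it also contains. -/
theorem eq_zero_of_forall_one_div_smul_mem_zmultiples {G : Type*} [AddCommGroup G] [Module ℚ G]
    {e g : G} (h : ∀ n : ℕ+, (1 / ((n : ℕ) : ℚ)) • g ∈ AddSubgroup.zmultiples e) : g = 0 := by
  obtain ⟨m, hm⟩ := AddSubgroup.mem_zmultiples_iff.1 (h 1)
  obtain ⟨l, hl⟩ := AddSubgroup.mem_zmultiples_iff.1 (h m.natAbs.succPNat)
  simp only [PNat.one_coe, Nat.cast_one, div_one, one_smul] at hm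
  rw [← Int.cast_smul_eq_zsmul ℚ] at hm hl
  have hn : ((m.natAbs.succPNat : ℕ) : ℚ) ≠ 0 := Nat.cast_ne_zero.2 (PNat.ne_zero _)
  have hg : (((m.natAbs.succPNat : ℕ) : ℚ) * l) • e = g := by
    rw [mul_smul, hl, smul_smul, mul_one_div_cancel hn, one_smul]
  rcases eq_or_ne e 0 with rfl | he
  · rw [← hm, smul_zero]
  have hml : (m : ℚ) = ((m.natAbs.succPNat : ℕ) : ℚ) * l :=
    smul_left_injective ℚ he (hm.trans hg.symm)
  have hdvd : ((m.natAbs + 1 : ℕ) : ℤ) ∣ m :=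
    ⟨l, Int.cast_injective (α := ℚ) (by rw [Int.cast_mul, Int.cast_natCast]; exact hml)⟩
  have hm0 : m = 0 := Int.eq_zero_of_abs_lt_dvd hdvd (by rw [Int.abs_eq_natAbs]; omega)
  rw [← hm, hm0, Int.cast_zero, zero_smul]

/-- If `G` is a `ℚ`-vector space and `π : G → ℝ/ℤ` a homomorphism whose kernel is `ℤ·e`,
then `π̂ : G → ∏_{n ∈ ℕ+} ℝ/ℤ`, `π̂ g n = π ((1/n) • g)`, is an injective additive group
homomorphism whose image consists of compatible sequences. -/
theorem stmt_15 {G : Type*} [AddCommGroup G] [Module ℚ G]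
    (π : G →+ AddCircle (1 : ℝ)) (e : G) (hker : π.ker = AddSubgroup.zmultiples e)
    (πhat : G → (ℕ+ → AddCircle (1 : ℝ)))
    (hπhat : ∀ (g : G) (n : ℕ+), πhat g n = π ((1 / ((n : ℕ) : ℚ)) • g)) :
    Function.Injective πhat ∧
    (∀ g g' : G, πhat (g + g') = πhat g + πhat g') ∧
    (∀ (g : G) (i k : ℕ+), (k : ℕ) • πhat g (i * k) = πhat g i) := by
  have hadd : ∀ g g' : G, πhat (g + g') = πhat g + πhat g' := fun g g' ↦ by
    funext n
    simp only [hπhat, Pi.add_apply, smul_add, map_add]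
  refine ⟨fun g g' hgg' ↦ ?_, hadd, fun g i k ↦ ?_⟩
  · refine sub_eq_zero.1 (eq_zero_of_forall_one_div_smul_mem_zmultiples (e := e) fun n ↦ ?_)
    rw [← hker, AddMonoidHom.mem_ker, smul_sub, map_sub, ← hπhat, ← hπhat, hgg', sub_self]
  · have hk : ((k : ℕ) : ℚ) ≠ 0 := by simp
    rw [hπhat, hπhat, ← map_nsmul, ← Nat.cast_smul_eq_nsmul ℚ, smul_smul, PNat.mul_coe,
      Nat.cast_mul, mul_one_div, div_mul_cancel_right₀ hk, one_div]
end

section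
/- Let G and G' be ℚ-vector spaces with surjective additive homomorphisms π : G → ℝ/ℤ and π' : G' → ℝ/ℤ, and let e ∈ G, e' ∈ G' be elements with ker(π) = ℤ·e, ker(π') = ℤ·e', satisfying the normalization π((1/n)·e) = mod_ℤ(1/n) and π'((1/n)·e') = mod_ℤ(1/n) for every positive integer n. Define π̂ : G → ∏_{n ∈ ℕ⁺} ℝ/ℤ by π̂(g)(n) = π((1/n)·g), and π̂' similarly. Then there exists a group isomorphism φ : G → G' with π'(φ(g)) = π(g) for all g ∈ G and φ(e) = e' if and only if the images of π̂ and π̂' in ∏_{n ∈ ℕ⁺} ℝ/ℤ are equal. -/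
/-- If the kernel of `π : G →+ ℝ/ℤ` is generated by an element `e` with
`π ((1/n) • e) = mod_ℤ (1/n)` for all `n`, then an element `g` is determined by the values
`π ((1/n) • g)`. -/
theorem AddCircle.eq_of_forall_map_one_div_smul_eq {G : Type*} [AddCommGroup G] [Module ℚ G]
    (π : G →+ AddCircle (1 : ℝ)) (e : G) (hker : π.ker = AddSubgroup.zmultiples e)
    (hnorm : ∀ n : ℕ+, π ((1 / ((n : ℕ) : ℚ)) • e) = ((1 / ((n : ℕ) : ℝ) : ℝ) : AddCircle (1 : ℝ)))
    {g h : G} (hgh : ∀ n : ℕ+, π ((1 / ((n : ℕ) : ℚ)) • g) = π ((1 / ((n : ℕ) : ℚ)) • h)) :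
    g = h := by
  have hmem : g - h ∈ π.ker := by
    have h1 := hgh 1
    simp only [PNat.one_coe, Nat.cast_one, div_one, one_smul] at h1
    rw [AddMonoidHom.mem_ker, map_sub, h1, sub_self]
  rw [hker, AddSubgroup.mem_zmultiples_iff] at hmem
  obtain ⟨k, hk⟩ := hmem
  have hz := hgh k.natAbs.succPNat
  rw [← sub_eq_zero, ← map_sub, ← smul_sub, ← hk, smul_comm, map_zsmul, hnorm,
    ← AddCircle.coe_zsmul, AddCircle.coe_eq_zero_iff] at hz
  obtain ⟨m, hm⟩ := hz
  simp only [Nat.succPNat_coe, Nat.succ_eq_add_one, zsmul_eq_mul, mul_one] at hm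
  have hpos : ((k.natAbs + 1 : ℕ) : ℝ) ≠ 0 := by positivity
  have hm' : m * ((k.natAbs + 1 : ℕ) : ℤ) = k := by
    rw [mul_one_div, eq_div_iff hpos] at hm
    apply Int.cast_injective (α := ℝ)
    rwa [Int.cast_mul, Int.cast_natCast]
  have hk0 : k = 0 := Int.eq_zero_of_abs_lt_dvd (Dvd.intro_left m hm') (by rw [Int.abs_eq_natAbs]; omega)
  rw [hk0, zero_smul] at hk
  exact sub_eq_zero.mp hk.symm


/-- Two extensions `0 → ℤ → G → ℝ/ℤ → 0` (with `G, G'` `ℚ`-vector spaces, distinguished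
kernel generators `e, e'` normalized so that `π ((1/n) • e) = mod_ℤ (1/n)`) are isomorphic
over `ℝ/ℤ` by an isomorphism sending `e` to `e'` if and only if the images of
`π̂ : g ↦ (π ((1/n) • g))_n` and `π̂'` in `∏_{n ∈ ℕ+} ℝ/ℤ` coincide. -/
theorem stmt_16 {G G' : Type*} [AddCommGroup G] [Module ℚ G] [AddCommGroup G'] [Module ℚ G']
    (π : G →+ AddCircle (1 : ℝ)) (π' : G' →+ AddCircle (1 : ℝ))
    (hπ : Function.Surjective π) (hπ' : Function.Surjective π')
    (e : G) (e' : G')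
    (hker : π.ker = AddSubgroup.zmultiples e) (hker' : π'.ker = AddSubgroup.zmultiples e')
    (hnorm : ∀ n : ℕ+, π ((1 / ((n : ℕ) : ℚ)) • e) = ((1 / ((n : ℕ) : ℝ) : ℝ) : AddCircle (1 : ℝ)))
    (hnorm' : ∀ n : ℕ+, π' ((1 / ((n : ℕ) : ℚ)) • e') = ((1 / ((n : ℕ) : ℝ) : ℝ) : AddCircle (1 : ℝ)))
    (πhat : G → (ℕ+ → AddCircle (1 : ℝ))) (πhat' : G' → (ℕ+ → AddCircle (1 : ℝ)))
    (hπhat : ∀ (g : G) (n : ℕ+), πhat g n = π ((1 / ((n : ℕ) : ℚ)) • g))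
    (hπhat' : ∀ (g : G') (n : ℕ+), πhat' g n = π' ((1 / ((n : ℕ) : ℚ)) • g)) :
    (∃ φ : G ≃+ G', (∀ g : G, π' (φ g) = π g) ∧ φ e = e') ↔
      Set.range πhat = Set.range πhat' := by
  have hinj : Function.Injective πhat := fun g h hgh ↦
    AddCircle.eq_of_forall_map_one_div_smul_eq π e hker hnorm fun n ↦ by
      rw [← hπhat, ← hπhat, hgh]
  have hinj' : Function.Injective πhat' := fun g h hgh ↦
    AddCircle.eq_of_forall_map_one_div_smul_eq π' e' hker' hnorm' fun n ↦ by
      rw [← hπhat', ← hπhat', hgh]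
  have hadd (g h : G) : πhat (g + h) = πhat g + πhat h := by
    ext n; simp only [hπhat, Pi.add_apply, smul_add, map_add]
  have hadd' (g h : G') : πhat' (g + h) = πhat' g + πhat' h := by
    ext n; simp only [hπhat', Pi.add_apply, smul_add, map_add]
  constructor
  · rintro ⟨φ, hφ, -⟩
    have hcomp : πhat' ∘ φ = πhat := by
      ext g n
      rw [Function.comp_apply, hπhat', hπhat, ← map_rat_smul φ, hφ]
    rw [← hcomp, φ.surjective.range_comp]
  · intro hrange
    let ψ : G ≃ G' := (Equiv.ofInjective πhat hinj).trans
      ((Equiv.setCongr hrange).trans (Equiv.ofInjective πhat' hinj').symm)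
    have hψ (g : G) : πhat' (ψ g) = πhat g :=
      Equiv.apply_ofInjective_symm hinj' (Equiv.setCongr hrange (Equiv.ofInjective πhat hinj g))
    refine ⟨AddEquiv.mk' ψ fun g h ↦ hinj' ?_, fun g ↦ ?_, hinj' ?_⟩
    · rw [hadd', hψ, hψ, hψ, hadd]
    · change π' (ψ g) = π g
      simpa [hπhat, hπhat'] using congrFun (hψ g) 1
    · refine (hψ e).trans (funext fun n ↦ ?_)
      rw [hπhat, hπhat', hnorm, hnorm']
end

section
/- Let Ŝ be the subgroup of ∏_{n ∈ ℕ⁺} ℝ/ℤ consisting of compatible sequences (k • h(i·k) = h(i) for all positive integers i, k), and let ẑ : ℝ → Ŝ be the embedding ẑ(x)(n) = mod_ℤ(x/n). Then there exists a family of cardinality 2^{ℵ₀} of pairwise distinct subgroups G of Ŝ such that each G: (i) is divisible and contains ẑ(1); (ii) satisfies {h ∈ G : h(1) = 0} = ℤ·ẑ(1); and (iii) projects onto ℝ/ℤ under the first-coordinate map h ↦ h(1). -/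
/-- The homomorphism sending `x` to the compatible sequence `n ↦ Φ (x / n)`. -/
noncomputable def divisionSequence {A : Type*} [AddCommGroup A] (Φ : ℝ →+ A) : ℝ →+ (ℕ+ → A) where
  toFun x n := Φ (x / (n : ℕ))
  map_zero' := by ext; simp
  map_add' x y := by ext; simp [add_div]

@[simp]
lemma divisionSequence_apply {A : Type*} [AddCommGroup A] (Φ : ℝ →+ A) (x : ℝ) (n : ℕ+) :
    divisionSequence Φ x n = Φ (x / (n : ℕ)) := rfl

/-- The projection `ℝ → ℝ/ℤ` perturbed by a character of `ℚ` along a rational functional. -/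
noncomputable def twistedProjection (χ : ℚ →+ AddCircle (1 : ℝ)) (l : ℝ →ₗ[ℚ] ℚ) :
    ℝ →+ AddCircle (1 : ℝ) :=
  QuotientAddGroup.mk' (AddSubgroup.zmultiples (1 : ℝ)) + χ.comp l.toAddMonoidHom

lemma twistedProjection_apply (χ : ℚ →+ AddCircle (1 : ℝ)) (l : ℝ →ₗ[ℚ] ℚ) (x : ℝ) :
    twistedProjection χ l x = (x : AddCircle (1 : ℝ)) + χ (l x) := rfl

lemma AddCircle.exists_int_of_coe_eq_zero {x : ℝ} (h : (x : AddCircle (1 : ℝ)) = 0) :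
    ∃ n : ℤ, x = n := by
  obtain ⟨n, hn⟩ := (AddCircle.coe_eq_zero_iff (1 : ℝ)).1 h
  exact ⟨n, by simpa using hn.symm⟩

lemma LinearMap.map_ratCast_eq_zero {l : ℝ →ₗ[ℚ] ℚ} (hl : l 1 = 0) (q : ℚ) :
    l (q : ℝ) = 0 := by
  have h : (q : ℝ) = q • (1 : ℝ) := by simp [Rat.smul_def]
  rw [h, map_smul, hl, smul_zero]

/-- The triadic rationals `ℤ[1/3]`, as an additive subgroup of `ℚ`. -/
def triadicRationals : AddSubgroup ℚ where
  carrier := {q | ∃ (k : ℕ) (a : ℤ), q * 3 ^ k = a}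
  zero_mem' := ⟨0, 0, by simp⟩
  add_mem' := by
    rintro x y ⟨k, a, hx⟩ ⟨m, b, hy⟩
    refine ⟨k + m, a * 3 ^ m + b * 3 ^ k, ?_⟩
    push_cast
    rw [← hx, ← hy]
    ring
  neg_mem' := by
    rintro x ⟨k, a, hx⟩
    exact ⟨k, -a, by push_cast; rw [← hx]; ring⟩

lemma one_div_three_pow_mem_triadicRationals (k : ℕ) : (1 / 3 ^ k : ℚ) ∈ triadicRationals :=
  ⟨k, 1, by simp⟩

lemma one_half_notMem_triadicRationals : (1 / 2 : ℚ) ∉ triadicRationals := by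
  rintro ⟨k, a, h⟩
  have h' : (3 : ℤ) ^ k = 2 * a := by
    have : (3 : ℚ) ^ k = 2 * a := by linarith
    exact_mod_cast this
  have hodd : Odd ((3 : ℤ) ^ k) := Odd.pow (by decide)
  rw [h'] at hodd
  exact Int.not_odd_iff_even.2 (even_two_mul a) hodd

/-- There is a character of `ℚ` with values in `ℚ/ℤ` that kills every `1 / 3 ^ k` but not `1 / 2`. -/
lemma exists_rat_character :
    ∃ χ : ℚ →+ AddCircle (1 : ℝ), (∀ q, ∃ s : ℚ, χ q = ((s : ℝ) : AddCircle (1 : ℝ))) ∧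
      (∀ k : ℕ, χ (1 / 3 ^ k) = 0) ∧ χ (1 / 2) ≠ 0 := by
  have hne : ((1 / 2 : ℚ) : ℚ ⧸ triadicRationals) ≠ 0 := fun h =>
    one_half_notMem_triadicRationals ((QuotientAddGroup.eq_zero_iff _).1 h)
  obtain ⟨c, hc⟩ := CharacterModule.exists_character_apply_ne_zero_of_ne_zero hne
  let c' : (ℚ ⧸ triadicRationals) →+ AddCircle (1 : ℚ) := c
  let ι : AddCircle (1 : ℚ) →+ AddCircle (1 : ℝ) :=
    QuotientAddGroup.map (AddSubgroup.zmultiples (1 : ℚ)) (AddSubgroup.zmultiples (1 : ℝ))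
      (Rat.castHom ℝ).toAddMonoidHom (by
        rintro _ ⟨n, rfl⟩
        exact ⟨n, by simp⟩)
  have hι : ∀ s : ℚ, ι (s : AddCircle (1 : ℚ)) = ((s : ℝ) : AddCircle (1 : ℝ)) := fun _ => rfl
  refine ⟨ι.comp (c'.comp (QuotientAddGroup.mk' triadicRationals)), fun q => ?_, fun k => ?_,
    fun h => hc ?_⟩
  · obtain ⟨s, hs⟩ := QuotientAddGroup.mk_surjective (c' (q : ℚ ⧸ triadicRationals))
    exact ⟨s, by rw [← hι]; exact congrArg ι hs.symm⟩
  · have h : ((1 / 3 ^ k : ℚ) : ℚ ⧸ triadicRationals) = 0 :=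
      (QuotientAddGroup.eq_zero_iff _).2 (one_div_three_pow_mem_triadicRationals k)
    have h' : ι (c' ((1 / 3 ^ k : ℚ) : ℚ ⧸ triadicRationals)) = 0 := by rw [h]; simp
    exact h'
  · obtain ⟨s, hs⟩ := QuotientAddGroup.mk_surjective (c' ((1 / 2 : ℚ) : ℚ ⧸ triadicRationals))
    have h' : ((s : ℝ) : AddCircle (1 : ℝ)) = 0 := by
      rw [← hι]; exact (congrArg ι hs).trans h
    obtain ⟨n, hn⟩ := AddCircle.exists_int_of_coe_eq_zero h'
    refine hs.symm.trans ((AddCircle.coe_eq_zero_iff (1 : ℚ)).2 ⟨n, ?_⟩)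
    have hn' : s = n := by exact_mod_cast hn
    simp [hn']

/-- There are continuum many rational functionals on `ℝ` that vanish at `1` and are separated by
a dual family of vectors. -/
lemma exists_dual_family_vanishing_at_one :
    ∃ (l : ℝ → ℝ →ₗ[ℚ] ℚ) (v : ℝ → ℝ), (∀ α, l α 1 = 0) ∧ (∀ α, l α (v α) = 1) ∧
      ∀ α β, α ≠ β → l β (v α) = 0 := by
  let b := Module.Basis.ofVectorSpace ℚ ℝ
  have hcard : Cardinal.mk (Module.Basis.ofVectorSpaceIndex ℚ ℝ) = Cardinal.continuum :=
    b.mk_eq_rank''.trans Real.rank_rat_real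
  have : Infinite (Module.Basis.ofVectorSpaceIndex ℚ ℝ) := by
    rw [Cardinal.infinite_iff, hcard]
    exact Cardinal.aleph0_le_continuum
  have hcompl := Cardinal.mk_compl_finset_of_infinite (b.repr 1).support
  obtain ⟨e⟩ := Cardinal.eq.1 (Cardinal.mk_real.trans (hcard.symm.trans hcompl.symm))
  refine ⟨fun α => b.coord (e α), fun α => b (e α), fun α => ?_, fun α => ?_, fun α β h => ?_⟩
  · exact Finsupp.notMem_support_iff.1 (e α).2
  · simp
  · have hne : (e α : Module.Basis.ofVectorSpaceIndex ℚ ℝ) ≠ e β := fun h' =>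
      h (e.injective (Subtype.ext h'))
    simp [hne]

section TwistedProjection

variable {χ : ℚ →+ AddCircle (1 : ℝ)} {l : ℝ →ₗ[ℚ] ℚ}

lemma twistedProjection_ratCast (hl : l 1 = 0) (q : ℚ) :
    twistedProjection χ l q = ((q : ℝ) : AddCircle (1 : ℝ)) := by
  rw [twistedProjection_apply, LinearMap.map_ratCast_eq_zero hl, map_zero, add_zero]

lemma exists_int_of_twistedProjection_eq_zero
    (hχ : ∀ q, ∃ s : ℚ, χ q = ((s : ℝ) : AddCircle (1 : ℝ))) (hl : l 1 = 0) {x : ℝ}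
    (hx : twistedProjection χ l x = 0) : ∃ n : ℤ, x = n := by
  obtain ⟨s, hs⟩ := hχ (l x)
  have h := hx
  rw [twistedProjection_apply, hs, ← AddCircle.coe_add] at h
  obtain ⟨n, hn⟩ := AddCircle.exists_int_of_coe_eq_zero h
  have hq : x = ((n - s : ℚ) : ℝ) := by push_cast; linarith
  rw [hq, twistedProjection_ratCast hl] at hx
  rw [hq]
  exact AddCircle.exists_int_of_coe_eq_zero hx

lemma twistedProjection_surjective
    (hχ : ∀ q, ∃ s : ℚ, χ q = ((s : ℝ) : AddCircle (1 : ℝ))) (hl : l 1 = 0) :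
    Function.Surjective (twistedProjection χ l) := by
  intro t
  obtain ⟨x, rfl⟩ := QuotientAddGroup.mk_surjective t
  obtain ⟨s, hs⟩ := hχ (l x)
  refine ⟨x - s, ?_⟩
  rw [map_sub, twistedProjection_ratCast hl, twistedProjection_apply, hs, add_sub_cancel_right]

end TwistedProjection

lemma eq_zero_of_forall_coe_div_three_pow_eq_zero {x : ℝ}
    (h : ∀ k : ℕ, ((x / 3 ^ k : ℝ) : AddCircle (1 : ℝ)) = 0) : x = 0 := by
  obtain ⟨k, hk⟩ := pow_unbounded_of_one_lt |x| (by norm_num : (1 : ℝ) < 3)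
  obtain ⟨n, hn⟩ := AddCircle.exists_int_of_coe_eq_zero (h k)
  have hlt : |(n : ℝ)| < 1 := by
    rw [← hn, abs_div, abs_of_pos (by positivity : (0 : ℝ) < 3 ^ k)]
    exact (div_lt_one (by positivity)).2 hk
  have hn0 : n = 0 := Int.abs_lt_one_iff.1 (by exact_mod_cast hlt)
  rw [hn0, Int.cast_zero] at hn
  exact (div_eq_zero_iff.1 hn).resolve_right (by positivity)

/-- If `l x = 1` and `l' x = 0`, the division sequence of `x` for the `l`-twisted projection is not
a division sequence for the `l'`-twisted projection. -/
lemma divisionSequence_twistedProjection_ne {χ : ℚ →+ AddCircle (1 : ℝ)} {l l' : ℝ →ₗ[ℚ] ℚ}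
    (hχ : ∀ q, ∃ s : ℚ, χ q = ((s : ℝ) : AddCircle (1 : ℝ)))
    (hχ3 : ∀ k : ℕ, χ (1 / 3 ^ k) = 0) (hχ2 : χ (1 / 2) ≠ 0) (hl' : l' 1 = 0)
    {x : ℝ} (hx : l x = 1) (hx' : l' x = 0) (y : ℝ) :
    divisionSequence (twistedProjection χ l') y ≠ divisionSequence (twistedProjection χ l) x := by
  intro h
  have hdiv : ∀ (f : ℝ →ₗ[ℚ] ℚ) (z : ℝ) (n : ℕ), f (z / n) = f z / n := by
    intro f z n
    have hz : z / n = ((n : ℚ)⁻¹) • z := by rw [Rat.smul_def]; push_cast; ring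
    rw [hz, map_smul, smul_eq_mul, div_eq_inv_mul]
  have hn : ∀ n : ℕ+, ((y / (n : ℕ) : ℝ) : AddCircle (1 : ℝ)) + χ (l' y / (n : ℕ)) =
      ((x / (n : ℕ) : ℝ) : AddCircle (1 : ℝ)) + χ (1 / (n : ℕ)) := by
    intro n
    have := congrFun h n
    simpa only [divisionSequence_apply, twistedProjection_apply, hdiv, hx] using this
  have hy : l' y = 0 := by
    have h1 := hn 1
    obtain ⟨s, hs⟩ := hχ (l' y)
    obtain ⟨t, ht⟩ := hχ 1
    simp only [PNat.one_coe, Nat.cast_one, div_one] at h1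
    rw [hs, ht, ← AddCircle.coe_add, ← AddCircle.coe_add, ← sub_eq_zero, ← AddCircle.coe_sub] at h1
    obtain ⟨m, hm⟩ := AddCircle.exists_int_of_coe_eq_zero h1
    have hyx : y = x + ((m + t - s : ℚ) : ℝ) := by push_cast; linarith
    rw [hyx, map_add, hx', LinearMap.map_ratCast_eq_zero hl', add_zero]
  have hsub : ∀ n : ℕ+, (((y - x) / (n : ℕ) : ℝ) : AddCircle (1 : ℝ)) = χ (1 / (n : ℕ)) := by
    intro n
    have := hn n
    rw [hy, zero_div, map_zero, add_zero] at this
    rw [sub_div, AddCircle.coe_sub, this, add_sub_cancel_left]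
  have hyx : y - x = 0 := eq_zero_of_forall_coe_div_three_pow_eq_zero fun k => by
    have := hsub (3 ^ k)
    push_cast at this
    rw [this, hχ3]
  have h2 := hsub 2
  rw [hyx, zero_div, AddCircle.coe_zero] at h2
  exact hχ2 (by simpa using h2.symm)


/-- There is a family, of cardinality `2^ℵ₀` (here indexed injectively by `ℝ`), of pairwise
distinct subgroups `G` of the group `Ŝ` of compatible sequences in `∏_{n ∈ ℕ+} ℝ/ℤ`, each
of which (i) is divisible and contains `ẑ(1) = (mod_ℤ (1/n))_n`; (ii) satisfies
`{h ∈ G : h 1 = 0} = ℤ · ẑ(1)`; and (iii) projects onto `ℝ/ℤ` under `h ↦ h 1`. -/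
theorem stmt_17 (z1 : ℕ+ → AddCircle (1 : ℝ))
    (hz1 : ∀ n : ℕ+, z1 n = ((1 / ((n : ℕ) : ℝ) : ℝ) : AddCircle (1 : ℝ))) :
    ∃ Gfam : ℝ → AddSubgroup (ℕ+ → AddCircle (1 : ℝ)),
      Function.Injective Gfam ∧
      ∀ α : ℝ,
        (∀ h ∈ Gfam α, ∀ i k : ℕ+, (k : ℕ) • h (i * k) = h i) ∧
        (∀ h ∈ Gfam α, ∀ m : ℕ, 0 < m → ∃ g ∈ Gfam α, m • g = h) ∧
        z1 ∈ Gfam α ∧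
        (∀ h : ℕ+ → AddCircle (1 : ℝ),
          (h ∈ Gfam α ∧ h 1 = 0) ↔ (∃ m : ℤ, h = m • z1)) ∧
        (∀ t : AddCircle (1 : ℝ), ∃ h ∈ Gfam α, h 1 = t) := by
  obtain ⟨χ, hχ, hχ3, hχ2⟩ := exists_rat_character
  obtain ⟨l, v, hl, hv, hlv⟩ := exists_dual_family_vanishing_at_one
  have hz : ∀ α, divisionSequence (twistedProjection χ (l α)) 1 = z1 := by
    intro α
    ext n
    have hn : (1 / (n : ℕ) : ℝ) = ((1 / (n : ℕ) : ℚ) : ℝ) := by push_cast; rfl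
    rw [hz1, divisionSequence_apply, hn, twistedProjection_ratCast (hl α)]
  refine ⟨fun α => (divisionSequence (twistedProjection χ (l α))).range, fun α β hαβ => ?_,
    fun α => ⟨?_, ?_, ⟨1, hz α⟩, fun h => ⟨?_, ?_⟩, fun t => ?_⟩⟩
  · by_contra hne
    have hmem : divisionSequence (twistedProjection χ (l α)) (v α) ∈
        (divisionSequence (twistedProjection χ (l β))).range := by
      have hle := hαβ.le
      exact hle ⟨v α, rfl⟩
    obtain ⟨y, hy⟩ := hmem
    exact divisionSequence_twistedProjection_ne hχ hχ3 hχ2 (hl β) (hv α) (hlv α β hne) y hy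
  · rintro _ ⟨x, rfl⟩ i k
    have hk : ((k : ℕ) : ℝ) ≠ 0 := by exact_mod_cast k.ne_zero
    rw [divisionSequence_apply, divisionSequence_apply, ← map_nsmul, nsmul_eq_mul, PNat.mul_coe,
      Nat.cast_mul]
    congr 1
    field_simp
  · rintro _ ⟨x, rfl⟩ m hm
    have hm' : (m : ℝ) ≠ 0 := by exact_mod_cast hm.ne'
    refine ⟨_, ⟨x / m, rfl⟩, ?_⟩
    rw [← map_nsmul, nsmul_eq_mul, mul_div_cancel₀ x hm']
  · rintro ⟨⟨x, rfl⟩, hx⟩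
    rw [divisionSequence_apply, PNat.one_coe, Nat.cast_one, div_one] at hx
    obtain ⟨n, rfl⟩ := exists_int_of_twistedProjection_eq_zero hχ (hl α) hx
    exact ⟨n, by rw [← hz α, ← map_zsmul, zsmul_one]⟩
  · rintro ⟨m, rfl⟩
    refine ⟨⟨m, by rw [← hz α, ← map_zsmul, zsmul_one]⟩, ?_⟩
    have h1 : z1 1 = 0 := by simp [hz1]
    rw [Pi.smul_apply, h1, smul_zero]
  · obtain ⟨x, hx⟩ := twistedProjection_surjective hχ (hl α) t
    exact ⟨_, ⟨x, rfl⟩, by simpa using hx⟩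
end
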